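/- Let n ≥ 2 and 1.5·ln(n)/n ≤ p < 1, and let G be an Erdős–Rényi random graph G(n,p) on vertex set {1,…,n} with s = 1 and t = n. Then for every deterministic adaptive node-incidence query algorithm making at most q queries, the probability that s and t are connected in the subgraph formed by the union of all edge sets returned by the q queries is at most p²·n·(q+1)² + q/√n. -/

import Mathlib

/-- The potential edges of a graph on vertex set `Fin n`: unordered pairs of distinct
vertices. -/
abbrev EdgeSlot (n : ℕ) := {e : Sym2 (Fin n) // ¬e.IsDiag}

/-- A graph is encoded as `g : EdgeSlot n → Bool`, indicating which edges are present.
`gAdj g u v` says that `u` and `v` are joined by an edge of `g`. -/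
def gAdj {n : ℕ} (g : EdgeSlot n → Bool) (u v : Fin n) : Prop :=
  ∃ e : EdgeSlot n, e.1 = s(u, v) ∧ g e = true

/-- The neighborhood of `v` in the graph `g` (determining the set of edges incident
to `v`). -/
noncomputable def nbhd {n : ℕ} (g : EdgeSlot n → Bool) (v : Fin n) : Finset (Fin n) := by
  classical exact Finset.univ.filter fun u => gAdj g v u

/-- The probability of the graph `g` under the Erdős–Rényi distribution `G(n,p)`: every
one of the `n(n−1)/2` possible edges is present independently with probability `p`. -/
noncomputable def erWeight {n : ℕ} (p : ℝ) (g : EdgeSlot n → Bool) : ℝ :=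
  ∏ e : EdgeSlot n, if g e then p else 1 - p

/-- The probability of the event `E` under the Erdős–Rényi distribution `G(n,p)`. -/
noncomputable def erProb (n : ℕ) (p : ℝ) (E : (EdgeSlot n → Bool) → Prop) : ℝ := by
  classical exact ∑ g : EdgeSlot n → Bool, if E g then erWeight p g else 0

/-- A deterministic adaptive node-incidence query algorithm: `nextQuery` selects the next
vertex to query from the transcript so far (the list of queried vertices together with the
answers, each answer being the neighborhood of the queried vertex, i.e. the set of edges
incident to it), and `output` produces a vertex sequence from the full transcript. -/
structure ERAlgo (n : ℕ) where
  nextQuery : List (Fin n × Finset (Fin n)) → Fin n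
  output : List (Fin n × Finset (Fin n)) → List (Fin n)

/-- The transcript of the first `q` queries of algorithm `A` run on the graph `g`. -/
noncomputable def erRun {n : ℕ} (A : ERAlgo n) (g : EdgeSlot n → Bool) : ℕ → List (Fin n × Finset (Fin n))
  | 0 => []
  | q + 1 =>
      let h := erRun A g q
      h ++ [(A.nextQuery h, nbhd g (A.nextQuery h))]

/-- `L` is a valid `s`-`t` path in the graph `g`: it starts at `s`, ends at `t`, and every
pair of consecutive vertices is joined by an edge of `g`. -/
def IsValidPath {n : ℕ} (g : EdgeSlot n → Bool) (s t : Fin n) (L : List (Fin n)) : Prop :=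
  L.head? = some s ∧ L.getLast? = some t ∧ L.Chain' (gAdj g)

/-- `u` and `v` are joined by an edge discovered in the transcript `h`. -/
def discAdj {n : ℕ} (h : List (Fin n × Finset (Fin n))) (u v : Fin n) : Prop :=
  ∃ e ∈ h, (e.1 = u ∧ v ∈ e.2) ∨ (e.1 = v ∧ u ∈ e.2)

section helpers
open Classical

variable {n : ℕ}

lemma erProb_def (p : ℝ) (E : (EdgeSlot n → Bool) → Prop) :
    erProb n p E = ∑ g : EdgeSlot n → Bool, if E g then erWeight p g else 0 := by
  unfold erProb
  rfl

lemma erWeight_nonneg {p : ℝ} (h0 : 0 ≤ p) (h1 : p ≤ 1) (g : EdgeSlot n → Bool) :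
    0 ≤ erWeight p g := by
  unfold erWeight
  refine Finset.prod_nonneg fun e _ => ?_
  split_ifs <;> linarith

lemma erProb_nonneg {p : ℝ} (h0 : 0 ≤ p) (h1 : p ≤ 1) (E : (EdgeSlot n → Bool) → Prop) :
    0 ≤ erProb n p E := by
  rw [erProb_def]
  refine Finset.sum_nonneg fun g _ => ?_
  split_ifs
  · exact erWeight_nonneg h0 h1 g
  · exact le_rfl

lemma erProb_mono {p : ℝ} (h0 : 0 ≤ p) (h1 : p ≤ 1) {E F : (EdgeSlot n → Bool) → Prop}
    (h : ∀ g, E g → F g) : erProb n p E ≤ erProb n p F := by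
  rw [erProb_def, erProb_def]
  refine Finset.sum_le_sum fun g _ => ?_
  have := erWeight_nonneg h0 h1 g
  by_cases hE : E g
  · simp [hE, h g hE]
  · simp only [hE, if_false]
    split_ifs
    · exact this
    · exact le_rfl

lemma erProb_exists_le {p : ℝ} (h0 : 0 ≤ p) (h1 : p ≤ 1) {ι : Type*} (s : Finset ι)
    (E : ι → (EdgeSlot n → Bool) → Prop) :
    erProb n p (fun g => ∃ i ∈ s, E i g) ≤ ∑ i ∈ s, erProb n p (E i) := by
  simp only [erProb_def]
  rw [Finset.sum_comm]
  refine Finset.sum_le_sum fun g _ => ?_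
  have hw := erWeight_nonneg h0 h1 g
  have hn : ∀ i ∈ s, 0 ≤ (if E i g then erWeight p g else 0) := by
    intro i _
    split_ifs
    · exact hw
    · exact le_rfl
  split_ifs with h
  · obtain ⟨i, hi, hE⟩ := h
    have := Finset.single_le_sum hn hi
    simpa [hE] using this
  · exact Finset.sum_nonneg hn

lemma erProb_or_le {p : ℝ} (h0 : 0 ≤ p) (h1 : p ≤ 1) (E F : (EdgeSlot n → Bool) → Prop) :
    erProb n p (fun g => E g ∨ F g) ≤ erProb n p E + erProb n p F := by
  simp only [erProb_def]
  rw [← Finset.sum_add_distrib]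
  refine Finset.sum_le_sum fun g _ => ?_
  have hw := erWeight_nonneg h0 h1 g
  by_cases hE : E g <;> by_cases hF : F g <;> simp [hE, hF, hw]

lemma erProb_fiber {p : ℝ} (f : (EdgeSlot n → Bool) → Fin n) (E : (EdgeSlot n → Bool) → Prop) :
    erProb n p E = ∑ v, erProb n p (fun g => f g = v ∧ E g) := by
  simp only [erProb_def]
  rw [Finset.sum_comm]
  refine Finset.sum_congr rfl fun g _ => ?_
  rw [Finset.sum_eq_single (f g)]
  · simp
  · intro b _ hb
    simp [hb.symm]
  · simp

lemma erProb_true (p : ℝ) : erProb n p (fun _ => True) = 1 := by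
  simp only [erProb_def, if_true, erWeight]
  have := Finset.prod_univ_sum (fun _ : EdgeSlot n => (Finset.univ : Finset Bool))
    (fun _ b => if b = true then p else 1 - p)
  rw [Fintype.piFinset_univ] at this
  rw [← this]
  simp

lemma erProb_const_le {p : ℝ} (c : Prop) :
    erProb n p (fun _ => c) = if c then 1 else 0 := by
  by_cases h : c
  · simp only [h, if_true]; exact erProb_true p
  · simp [h, erProb_def]

noncomputable def flipE (e : EdgeSlot n) (g : EdgeSlot n → Bool) : EdgeSlot n → Bool :=
  Function.update g e (!(g e))

lemma flipE_invol (e : EdgeSlot n) : Function.Involutive (flipE e) := by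
  intro g
  simp [flipE]

lemma erWeight_split (p : ℝ) (e : EdgeSlot n) (g : EdgeSlot n → Bool) :
    erWeight p g = (if g e then p else 1 - p) *
      ∏ e' ∈ Finset.univ.erase e, if g e' then p else 1 - p := by
  unfold erWeight
  exact (Finset.mul_prod_erase Finset.univ (fun e' : EdgeSlot n => if g e' = true then p else 1 - p)
    (Finset.mem_univ e)).symm

lemma flip_prod (p : ℝ) (e : EdgeSlot n) (g : EdgeSlot n → Bool) :
    (∏ e' ∈ Finset.univ.erase e, if flipE e g e' then p else 1 - p) =
      ∏ e' ∈ Finset.univ.erase e, if g e' then p else 1 - p := by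
  refine Finset.prod_congr rfl fun e' he' => ?_
  have : e' ≠ e := Finset.ne_of_mem_erase he'
  simp [flipE, this]

lemma erProb_edge (p : ℝ) (e : EdgeSlot n) (E : (EdgeSlot n → Bool) → Prop)
    (hE : ∀ g, E g → E (flipE e g)) :
    erProb n p (fun g => E g ∧ g e = true) = p * erProb n p E := by
  have hE' : ∀ g, E (flipE e g) ↔ E g := fun g =>
    ⟨fun h => by simpa [flipE_invol e g] using hE _ h, hE g⟩
  have key : (1 - p) * erProb n p (fun g => E g ∧ g e = true) =
      p * erProb n p (fun g => E g ∧ g e = false) := by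
    simp only [erProb_def, Finset.mul_sum]
    refine Eq.trans ?_ (Equiv.sum_comp (flipE_invol e).toPerm _)
    refine Finset.sum_congr rfl fun g _ => ?_
    simp only [Function.Involutive.coe_toPerm, hE']
    rw [erWeight_split p e g, erWeight_split p e (flipE e g), flip_prod]
    have : flipE e g e = !(g e) := by simp [flipE]
    rw [this]
    by_cases h1 : E g <;> cases h2 : g e <;> simp [h1]
    ring
  have tot : erProb n p E = erProb n p (fun g => E g ∧ g e = true)
      + erProb n p (fun g => E g ∧ g e = false) := by
    simp only [erProb_def]
    rw [← Finset.sum_add_distrib]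
    refine Finset.sum_congr rfl fun g _ => ?_
    by_cases h1 : E g <;> cases h2 : g e <;> simp [h1]
  rw [tot]
  linarith

/-- queried vertices -/
def Qd (h : List (Fin n × Finset (Fin n))) (v : Fin n) : Prop := ∃ e ∈ h, e.1 = v

lemma Qd_mono (A : ERAlgo n) (g : EdgeSlot n → Bool) {j i : ℕ} (hji : j ≤ i) {v : Fin n}
    (h : Qd (erRun A g j) v) : Qd (erRun A g i) v := by
  induction i, hji using Nat.le_induction with
  | base => exact h
  | succ i _ ih =>
    obtain ⟨e, he, h1⟩ := ih
    exact ⟨e, by simp [erRun, he], h1⟩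

lemma mem_nbhd (g : EdgeSlot n → Bool) (u v : Fin n) : u ∈ nbhd g v ↔ gAdj g v u := by
  simp [nbhd]

lemma gAdj_symm {g : EdgeSlot n → Bool} {u v : Fin n} (h : gAdj g u v) : gAdj g v u := by
  obtain ⟨e, h1, h2⟩ := h
  exact ⟨e, by rw [h1, Sym2.eq_swap], h2⟩

lemma nbhd_flip (g : EdgeSlot n → Bool) {v w u : Fin n} (e : EdgeSlot n) (he : e.1 = s(v, w))
    (h1 : u ≠ v) (h2 : u ≠ w) : nbhd (flipE e g) u = nbhd g u := by
  ext x
  rw [mem_nbhd, mem_nbhd]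
  unfold gAdj
  refine exists_congr fun e' => and_congr_right fun h => ?_
  have : e' ≠ e := by
    rintro rfl
    rw [he] at h
    have : u ∈ s(v, w) := by rw [h]; simp
    simp at this
    tauto
  simp [flipE, this]

lemma erRun_flip (A : ERAlgo n) (g : EdgeSlot n → Bool) {v w : Fin n} (e : EdgeSlot n)
    (he : e.1 = s(v, w)) (i : ℕ) (h1 : ¬ Qd (erRun A g i) v) (h2 : ¬ Qd (erRun A g i) w) :
    erRun A (flipE e g) i = erRun A g i := by
  induction i with
  | zero => rfl
  | succ i ih =>
    have ih := ih (fun h => h1 (Qd_mono A g (Nat.le_succ i) h))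
      (fun h => h2 (Qd_mono A g (Nat.le_succ i) h))
    simp only [erRun, ih]
    rw [nbhd_flip g e he]
    · intro h
      exact h1 ⟨_, by simp only [erRun]; exact List.mem_append_right _ (List.mem_singleton.2 rfl), h⟩
    · intro h
      exact h2 ⟨_, by simp only [erRun]; exact List.mem_append_right _ (List.mem_singleton.2 rfl), h⟩

lemma step_prob {p : ℝ} (h0 : 0 ≤ p) (h1 : p ≤ 1) (A : ERAlgo n) (i : ℕ) (w : Fin n)
    (P : List (Fin n × Finset (Fin n)) → Prop) :
    erProb n p (fun g => (P (erRun A g i) ∧ ¬ Qd (erRun A g i) w ∧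
        ¬ Qd (erRun A g i) (A.nextQuery (erRun A g i))) ∧
        w ∈ nbhd g (A.nextQuery (erRun A g i))) ≤
      p * erProb n p (fun g => P (erRun A g i) ∧ ¬ Qd (erRun A g i) w ∧
        ¬ Qd (erRun A g i) (A.nextQuery (erRun A g i))) := by
  rw [erProb_fiber (fun g => A.nextQuery (erRun A g i))]
  rw [erProb_fiber (fun g => A.nextQuery (erRun A g i)) (fun g => P (erRun A g i) ∧ _),
    Finset.mul_sum]
  refine Finset.sum_le_sum fun v _ => ?_
  by_cases hvw : v = w
  · refine le_trans (b := erProb n p (fun _ => False)) (erProb_mono h0 h1 ?_) ?_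
    · rintro g ⟨hv, -, hw⟩
      rw [hv, mem_nbhd] at hw
      obtain ⟨e, he, -⟩ := hw
      exact e.2 (by rw [he, hvw]; simp)
    · rw [erProb_const_le, if_neg id]
      exact mul_nonneg h0 (erProb_nonneg h0 h1 _)
  · let e : EdgeSlot n := ⟨s(v, w), by simpa using hvw⟩
    rw [← erProb_edge p e]
    · refine erProb_mono h0 h1 ?_
      rintro g ⟨hv, hE, hw⟩
      refine ⟨⟨hv, hE⟩, ?_⟩
      rw [hv, mem_nbhd] at hw
      obtain ⟨e', he', h⟩ := hw
      have : e' = e := Subtype.ext he'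
      rwa [this] at h
    · rintro g ⟨hv, hP, hw, hq⟩
      have := erRun_flip A g (v := v) (w := w) e rfl i (by rwa [hv] at hq) hw
      simp only [this]
      exact ⟨hv, hP, hw, hq⟩

lemma mem_erRun (A : ERAlgo n) (g : EdgeSlot n → Bool) (i : ℕ) :
    ∀ e ∈ erRun A g i, ∃ j < i, ¬ Qd (erRun A g j) (A.nextQuery (erRun A g j)) ∧
      e = (A.nextQuery (erRun A g j), nbhd g (A.nextQuery (erRun A g j))) := by
  induction i with
  | zero => intro e he; simp [erRun] at he
  | succ i ih =>
    have old : ∀ e ∈ erRun A g i, ∃ j < i + 1,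
        ¬ Qd (erRun A g j) (A.nextQuery (erRun A g j)) ∧
        e = (A.nextQuery (erRun A g j), nbhd g (A.nextQuery (erRun A g j))) := by
      intro e he
      obtain ⟨j, hj, h⟩ := ih e he
      exact ⟨j, by omega, h⟩
    intro e he
    simp only [erRun, List.mem_append, List.mem_singleton] at he
    rcases he with he | he
    · exact old e he
    · by_cases hq : Qd (erRun A g i) (A.nextQuery (erRun A g i))
      · obtain ⟨e', he', hv⟩ := hq
        obtain ⟨j, hj, h1, h2⟩ := old e' he'
        refine ⟨j, hj, h1, ?_⟩
        have hv' : A.nextQuery (erRun A g i) = A.nextQuery (erRun A g j) := by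
          rw [← hv, h2]
        rw [he, hv']
      · exact ⟨i, by omega, hq, he⟩

/-- touched vertices -/
def Dd (s t : Fin n) (h : List (Fin n × Finset (Fin n))) (w : Fin n) : Prop :=
  (w = s ∨ w = t) ∨ ∃ e ∈ h, w ∈ e.2

lemma discAdj_symm {h : List (Fin n × Finset (Fin n))} {u v : Fin n} (H : discAdj h u v) :
    discAdj h v u := by
  obtain ⟨e, he, h⟩ := H
  exact ⟨e, he, h.symm⟩

lemma reach_symm {h : List (Fin n × Finset (Fin n))} {u v : Fin n}
    (H : Relation.ReflTransGen (discAdj h) u v) : Relation.ReflTransGen (discAdj h) v u := by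
  induction H with
  | refl => exact .refl
  | tail _ h2 ih => exact .head (discAdj_symm h2) ih

lemma reach_touched {h : List (Fin n × Finset (Fin n))} {a w : Fin n}
    (H : Relation.ReflTransGen (discAdj h) a w) (hw : ¬ Qd h w) : w = a ∨ ∃ e ∈ h, w ∈ e.2 := by
  rcases Relation.ReflTransGen.cases_tail H with h1 | ⟨c, _, e, he, h2⟩
  · exact .inl h1
  · rcases h2 with h2 | h2
    · exact .inr ⟨e, he, h2.2⟩
    · exact absurd ⟨e, he, h2.1⟩ hw

lemma no_new (A : ERAlgo n) (g : EdgeSlot n → Bool) (s t a : Fin n) (ha : a = s ∨ a = t) (i : ℕ)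
    (hno : ∀ w, ¬ Qd (erRun A g i) w → Dd s t (erRun A g i) w →
      w ∉ nbhd g (A.nextQuery (erRun A g i)))
    (hv : ¬ Relation.ReflTransGen (discAdj (erRun A g i)) a (A.nextQuery (erRun A g i)))
    (b : Fin n) (H : Relation.ReflTransGen (discAdj (erRun A g (i + 1))) a b) :
    Relation.ReflTransGen (discAdj (erRun A g i)) a b := by
  have main : ∀ w, Relation.ReflTransGen (discAdj (erRun A g i)) a w →
      w ∉ nbhd g (A.nextQuery (erRun A g i)) := by
    intro w hw hmem
    by_cases hq : Qd (erRun A g i) w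
    · obtain ⟨e, he, h1⟩ := hq
      obtain ⟨j, hj, -, h2⟩ := mem_erRun A g i e he
      have h3 : e.2 = nbhd g w := by
        rw [← h1, h2]
      refine hv (hw.tail ⟨e, he, .inl ⟨h1, ?_⟩⟩)
      rw [h3, mem_nbhd]
      exact gAdj_symm ((mem_nbhd _ _ _).1 hmem)
    · refine hno w hq ?_ hmem
      rcases reach_touched hw hq with h | h
      · left; rw [h]; exact ha
      · exact .inr h
  induction H with
  | refl => exact .refl
  | tail _ h2 ih =>
    obtain ⟨e, he, h⟩ := h2
    simp only [erRun, List.mem_append, List.mem_singleton] at he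
    rcases he with he | he
    · exact ih.tail ⟨e, he, h⟩
    · subst he
      rcases h with h | h
      · simp only at h
        exact absurd (h.1 ▸ ih) hv
      · exact absurd h.2 (main _ ih)

lemma conn_event (A : ERAlgo n) (g : EdgeSlot n → Bool) (s t : Fin n) (hst : s ≠ t) (q : ℕ)
    (H : Relation.ReflTransGen (discAdj (erRun A g q)) s t) :
    ∃ i ∈ Finset.range q, ∃ w ∈ (Finset.univ : Finset (Fin n)),
      (Dd s t (erRun A g i) w ∧ ¬ Qd (erRun A g i) w ∧
        ¬ Qd (erRun A g i) (A.nextQuery (erRun A g i))) ∧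
        w ∈ nbhd g (A.nextQuery (erRun A g i)) := by
  induction q with
  | zero =>
    exfalso
    rcases Relation.ReflTransGen.cases_head H with h | ⟨c, ⟨e, he, _⟩, _⟩
    · exact hst h
    · simp [erRun] at he
  | succ i ih =>
    by_cases hc : Relation.ReflTransGen (discAdj (erRun A g i)) s t
    · obtain ⟨j, hj, h⟩ := ih hc
      exact ⟨j, by simp at hj ⊢; omega, h⟩
    by_contra hcon
    have hq : ¬ Qd (erRun A g i) (A.nextQuery (erRun A g i)) := by
      intro hq
      apply hc
      refine Relation.ReflTransGen.mono ?_ s t H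
      rintro u v ⟨e, he, h⟩
      simp only [erRun, List.mem_append, List.mem_singleton] at he
      rcases he with he | he
      · exact ⟨e, he, h⟩
      · obtain ⟨e', he', hv⟩ := hq
        obtain ⟨j, hj, h1, h2⟩ := mem_erRun A g i e' he'
        have : e = e' := by
          have hv' : A.nextQuery (erRun A g i) = A.nextQuery (erRun A g j) := by
            rw [← hv, h2]
          rw [he, h2, hv']
        exact ⟨e', he', this ▸ h⟩
    have hno : ∀ w, ¬ Qd (erRun A g i) w → Dd s t (erRun A g i) w →
        w ∉ nbhd g (A.nextQuery (erRun A g i)) := fun w h1 h2 h3 =>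
      hcon ⟨i, by simp, w, Finset.mem_univ _, ⟨h2, h1, hq⟩, h3⟩
    by_cases hv : Relation.ReflTransGen (discAdj (erRun A g i)) s (A.nextQuery (erRun A g i))
    · have hv' : ¬ Relation.ReflTransGen (discAdj (erRun A g i)) t
          (A.nextQuery (erRun A g i)) := fun h => hc (hv.trans (reach_symm h))
      exact hc (reach_symm (no_new A g s t t (.inr rfl) i hno hv' s (reach_symm H)))
    · exact hc (no_new A g s t s (.inl rfl) i hno hv t H)

lemma touched_prob {p : ℝ} (h0 : 0 ≤ p) (h1 : p ≤ 1) (A : ERAlgo n) (s t : Fin n) (i : ℕ)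
    (w : Fin n) :
    erProb n p (fun g => Dd s t (erRun A g i) w ∧ ¬ Qd (erRun A g i) w ∧
        ¬ Qd (erRun A g i) (A.nextQuery (erRun A g i))) ≤
      ((if w = s then 1 else 0) + (if w = t then 1 else 0)) + i * p := by
  refine le_trans (b := erProb n p (fun g => (w = s ∨ w = t) ∨ ∃ j ∈ Finset.range i,
    (True ∧ ¬ Qd (erRun A g j) w ∧ ¬ Qd (erRun A g j) (A.nextQuery (erRun A g j))) ∧
        w ∈ nbhd g (A.nextQuery (erRun A g j)))) (erProb_mono h0 h1 ?_) ?_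
  · rintro g ⟨hD, hq, -⟩
    rcases hD with hD | ⟨e, he, hw⟩
    · exact .inl hD
    · right
      obtain ⟨j, hj, h2, h3⟩ := mem_erRun A g i e he
      refine ⟨j, by simpa using hj, ⟨trivial, fun h => hq (Qd_mono A g hj.le h), h2⟩, ?_⟩
      rw [h3] at hw
      exact hw
  · refine (erProb_or_le h0 h1 _ _).trans (add_le_add ?_ ?_)
    · refine (erProb_or_le h0 h1 _ _).trans (add_le_add ?_ ?_) <;>
        (rw [erProb_const_le]; split_ifs <;> simp)
    · refine (erProb_exists_le h0 h1 _ _).trans ?_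
      refine (Finset.sum_le_card_nsmul _ _ p ?_).trans (by simp)
      intro j _
      refine (step_prob h0 h1 A j w (fun _ => True)).trans ?_
      refine mul_le_of_le_one_right h0 ?_
      rw [← erProb_true (n := n) p]
      exact erProb_mono h0 h1 fun _ _ => trivial

end helpers

/-- Let `2 ≤ n`, `1.5·ln(n)/n ≤ p < 1`, and let `G ~ G(n,p)` with `s = 1` (vertex `0` of
`Fin n`) and `t = n` (vertex `n−1`).  For every deterministic adaptive node-incidence query
algorithm making at most `q` queries, the probability that `s` and `t` are connected in the
subgraph formed by the union of all edges returned by the `q` queries is at most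
`p²·n·(q+1)² + q/√n`. -/
theorem stmt9 (n q : ℕ) (hn : 2 ≤ n) (p : ℝ)
    (hp1 : 1.5 * Real.log n / n ≤ p) (hp2 : p < 1) (A : ERAlgo n) :
    erProb n p (fun g =>
        Relation.ReflTransGen (discAdj (erRun A g q)) ⟨0, by omega⟩ ⟨n - 1, by omega⟩)
      ≤ p ^ 2 * n * ((q : ℝ) + 1) ^ 2 + q / Real.sqrt n := by
  have hn1 : (1 : ℝ) ≤ n := by exact_mod_cast (by omega : 1 ≤ n)
  have h0 : 0 ≤ p := le_trans (by have := Real.log_nonneg hn1; positivity) hp1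
  have h1 : p ≤ 1 := hp2.le
  have hst : (⟨0, by omega⟩ : Fin n) ≠ ⟨n - 1, by omega⟩ := by
    intro h
    simp only [Fin.mk.injEq] at h
    omega
  generalize (⟨0, by omega⟩ : Fin n) = s at *
  generalize (⟨n - 1, by omega⟩ : Fin n) = t at *
  refine (erProb_mono h0 h1 fun g hg => conn_event A g s t hst q hg).trans ?_
  have step : ∀ i ∈ Finset.range q, erProb n p (fun g => ∃ w ∈ (Finset.univ : Finset (Fin n)),
      (Dd s t (erRun A g i) w ∧ ¬ Qd (erRun A g i) w ∧
        ¬ Qd (erRun A g i) (A.nextQuery (erRun A g i))) ∧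
        w ∈ nbhd g (A.nextQuery (erRun A g i))) ≤ p * (2 + q * (n * p)) := by
    intro i hi
    refine (erProb_exists_le h0 h1 _ _).trans ?_
    have : ∑ w : Fin n, p * (((if w = s then (1 : ℝ) else 0) + (if w = t then 1 else 0)) + i * p)
        ≤ p * (2 + q * (n * p)) := by
      rw [← Finset.mul_sum]
      refine mul_le_mul_of_nonneg_left ?_ h0
      rw [Finset.sum_add_distrib, Finset.sum_add_distrib]
      simp only [Finset.sum_ite_eq', Finset.mem_univ, if_true, Finset.sum_const,
        Finset.card_univ, Fintype.card_fin, nsmul_eq_mul]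
      have hiq : (i : ℝ) ≤ q := by exact_mod_cast (Finset.mem_range.1 hi).le
      have : (i : ℝ) * (n * p) ≤ q * (n * p) := by gcongr
      linarith
    refine le_trans (Finset.sum_le_sum fun w _ => ?_) this
    refine (step_prob h0 h1 A i w (fun h => Dd s t h w)).trans ?_
    refine mul_le_mul_of_nonneg_left ?_ h0
    convert touched_prob h0 h1 A s t i w
  refine (erProb_exists_le h0 h1 _ _).trans ((Finset.sum_le_sum step).trans ?_)
  simp only [Finset.sum_const, Finset.card_range, nsmul_eq_mul]
  have hs : (1 : ℝ) ≤ Real.sqrt n := by rw [Real.one_le_sqrt]; exact hn1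
  have hsq : Real.sqrt n ^ 2 = n := Real.sq_sqrt (by linarith)
  have key : 2 * p ≤ 2 * (p ^ 2 * n) + 1 / Real.sqrt n := by
    have hpos : 0 < Real.sqrt n := by linarith
    set r := Real.sqrt n
    rw [← hsq]
    have h2 : 2 * p * r ≤ 2 * p ^ 2 * r ^ 2 * r + 1 := by
      nlinarith [sq_nonneg (p * r - 1), mul_nonneg (sq_nonneg (p * r)) (sub_nonneg.2 hs),
        sq_nonneg (p * r)]
    have : 2 * (p ^ 2 * r ^ 2) + 1 / r - 2 * p = (2 * p ^ 2 * r ^ 2 * r + 1 - 2 * p * r) / r := by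
      field_simp
    have h3 : 0 ≤ (2 * p ^ 2 * r ^ 2 * r + 1 - 2 * p * r) / r :=
      div_nonneg (by linarith) hpos.le
    linarith
  have hq0 : (0 : ℝ) ≤ q := Nat.cast_nonneg q
  have hk := mul_le_mul_of_nonneg_left key hq0
  have h5 : 0 ≤ p ^ 2 * n := by positivity
  have h6 : (q : ℝ) / Real.sqrt n = q * (1 / Real.sqrt n) := by ring
  rw [h6]
  nlinarith
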